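/- arXiv:1710.03841 — 2 statements merged into one kernel-verified Lean document; each statement's English description precedes it below -/
import Mathlib

section
/- Let E be a compact metric space, Ω = E^ℕ, p a fully supported Borel probability measure on E, f ∈ C(Ω), and L_f the Ruelle operator. Then there exist a Borel probability measure ν on Ω and a real number c > 0 such that ∫_Ω L_f φ dν = c ∫_Ω φ dν for all φ ∈ C(Ω); that is, the transpose of the Ruelle operator has an eigenmeasure with a positive eigenvalue. -/
open MeasureTheory Filter Topology

noncomputable section

/-- The sequence `(a, x₁, x₂, …)` obtained by prepending `a` to `x`. -/
def cons {E : Type*} (a : E) (x : ℕ → E) : ℕ → E := fun n => Nat.casesOn n a x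

/-- Collatz–Wielandt value of a positive operator bounded below on constants. -/
theorem collatz_aux {X : Type*} [TopologicalSpace X] [CompactSpace X] [Nonempty X]
    (T : C(X, ℝ) →L[ℝ] C(X, ℝ)) (hpos : ∀ φ : C(X, ℝ), (∀ x, 0 ≤ φ x) → ∀ x, 0 ≤ T φ x)
    (δ : ℝ) (hδ : 0 < δ) (h1 : ∀ x, δ ≤ T 1 x) :
    ∃ c : ℝ, 0 < c ∧ ∀ φ : C(X, ℝ), ¬ ∀ x, T φ x < c * φ x := by
  have exmin : ∀ g : C(X, ℝ), ∃ x, ∀ y, g x ≤ g y := fun g => by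
    obtain ⟨x, -, hx⟩ := isCompact_univ.exists_isMinOn Set.univ_nonempty g.continuous.continuousOn
    exact ⟨x, fun y => hx (Set.mem_univ y)⟩
  let S : Set ℝ := {l | ∃ ψ : C(X, ℝ), (∀ x, 0 < ψ x) ∧ ∀ x, T ψ x < l * ψ x}
  have hlow : ∀ l ∈ S, δ ≤ l := by
    rintro l ⟨ψ, hψ, hl⟩
    obtain ⟨x, hx⟩ := exmin ψ
    have h := hpos (ψ - ψ x • (1 : C(X, ℝ))) (fun y => by simpa using hx y) x
    rw [map_sub, map_smul] at h
    simp at h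
    have h2 := h1 x
    have h3 := hl x
    have h4 := hψ x
    by_contra! hc
    nlinarith
  have hne : S.Nonempty := by
    refine ⟨‖T 1‖ + 1, 1, fun x => by simp, fun x => ?_⟩
    have := (le_abs_self _).trans ((T 1).norm_coe_le_norm x)
    simp
    linarith
  have hbdd : BddBelow S := ⟨δ, hlow⟩
  refine ⟨sInf S, hδ.trans_le (le_csInf hne hlow), fun φ hφ => ?_⟩
  set c := sInf S with hc
  obtain ⟨x₀, hx₀⟩ := exmin (c • φ - T φ)
  obtain ⟨ε, hε, hεφ⟩ : ∃ ε > 0, ∀ x, T φ x ≤ c * φ x - ε := by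
    refine ⟨c * φ x₀ - T φ x₀, by linarith [hφ x₀], fun x => ?_⟩
    have := hx₀ x
    simp at this
    linarith
  have hN : 0 < ‖φ‖ + 1 := by positivity
  have hη : 0 < ε / (‖φ‖ + 1) := by positivity
  have hηε : ε / (‖φ‖ + 1) * (‖φ‖ + 1) = ε := by field_simp
  set η := ε / (‖φ‖ + 1)
  have hb : ∀ x, |φ x| ≤ ‖φ‖ := fun x => φ.norm_coe_le_norm x
  have hφpos : ∀ x, 0 < φ x := by
    intro x₁
    by_contra! hx₁
    obtain ⟨l, ⟨ψ, hψ, hl⟩, hlc⟩ := exists_lt_of_csInf_lt hne (show sInf S < c + η by linarith)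
    have hcl : c ≤ l := csInf_le hbdd ⟨ψ, hψ, hl⟩
    obtain ⟨x, hx⟩ := exmin ⟨fun x => φ x / ψ x,
      φ.continuous.div ψ.continuous (fun x => (hψ x).ne')⟩
    simp only [ContinuousMap.coe_mk] at hx
    obtain ⟨t, ht⟩ : ∃ t, t = - (φ x / ψ x) := ⟨_, rfl⟩
    have ht0 : 0 ≤ t := by
      have := hx x₁
      have := div_nonpos_of_nonpos_of_nonneg hx₁ (hψ x₁).le
      linarith
    have htx : t * ψ x = - φ x := by
      have := (hψ x).ne'
      rw [ht]; field_simp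
    have h := hpos (φ + t • ψ) (fun y => by
      have h1 := hx y
      rw [le_div_iff₀ (hψ y)] at h1
      simp only [ContinuousMap.add_apply, ContinuousMap.smul_apply, smul_eq_mul, ht]
      linarith) x
    rw [map_add, map_smul] at h
    simp at h
    have h3 := mul_le_mul_of_nonneg_left (hl x).le ht0
    have h4 := hεφ x
    have h5 : -φ x ≤ ‖φ‖ := (neg_le_abs _).trans (hb x)
    have h6 : t * (l * ψ x) = l * (- φ x) := by rw [← htx]; ring
    have h7 : (l - c) * (-φ x) ≤ (l - c) * ‖φ‖ :=
      mul_le_mul_of_nonneg_left h5 (by linarith)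
    have h8 : (l - c) * ‖φ‖ ≤ η * ‖φ‖ :=
      mul_le_mul_of_nonneg_right (by linarith) (norm_nonneg _)
    nlinarith
  have hmem : c - η ∈ S := by
    refine ⟨φ, hφpos, fun x => ?_⟩
    have h1 := hεφ x
    have h2 := mul_le_mul_of_nonneg_left ((le_abs_self _).trans (hb x)) hη.le
    nlinarith
  have := csInf_le hbdd hmem
  linarith

theorem riesz_aux {X : Type*} [TopologicalSpace X] [CompactSpace X] [T2Space X]
    [MeasurableSpace X] [BorelSpace X] (l : C(X, ℝ) →L[ℝ] ℝ)
    (hpos : ∀ φ : C(X, ℝ), (∀ x, 0 ≤ φ x) → 0 ≤ l φ) (h1 : l 1 = 1) :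
    ∃ ν : Measure X, IsProbabilityMeasure ν ∧ ∀ φ : C(X, ℝ), ∫ x, φ x ∂ν = l φ := by
  let L : CompactlySupportedContinuousMap X ℝ →ₗ[ℝ] ℝ :=
    { toFun := fun φ => l φ.toContinuousMap
      map_add' := fun a b => l.map_add a.toContinuousMap b.toContinuousMap
      map_smul' := fun a b => l.map_smul a b.toContinuousMap }
  let Λ := PositiveLinearMap.mk₀ L (fun φ hφ => hpos _ hφ)
  have key : ∀ φ : C(X, ℝ), ∫ x, φ x ∂(RealRMK.rieszMeasure Λ) = l φ := fun φ =>
    RealRMK.integral_rieszMeasure Λ ⟨φ, HasCompactSupport.of_compactSpace _⟩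
  refine ⟨RealRMK.rieszMeasure Λ, ?_, key⟩
  have h := key 1
  rw [h1] at h
  simp [Measure.real] at h
  constructor
  rw [← ENNReal.toReal_eq_one_iff]
  exact h

theorem eigen_aux {X : Type*} [TopologicalSpace X] [CompactSpace X] [T2Space X] [Nonempty X]
    [MeasurableSpace X] [BorelSpace X]
    (T : C(X, ℝ) →L[ℝ] C(X, ℝ)) (hpos : ∀ φ : C(X, ℝ), (∀ x, 0 ≤ φ x) → ∀ x, 0 ≤ T φ x)
    (δ : ℝ) (hδ : 0 < δ) (h1 : ∀ x, δ ≤ T 1 x) :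
    ∃ (ν : Measure X) (c : ℝ), IsProbabilityMeasure ν ∧ 0 < c ∧
      ∀ φ : C(X, ℝ), ∫ x, T φ x ∂ν = c * ∫ x, φ x ∂ν := by
  obtain ⟨c, hc, hφ⟩ := collatz_aux T hpos δ hδ h1
  let s : Set C(X, ℝ) := {φ | Set.MapsTo φ Set.univ (Set.Iio 0)}
  let A : C(X, ℝ) →ₗ[ℝ] C(X, ℝ) := T.toLinearMap - c • LinearMap.id
  have hs : IsOpen s := ContinuousMap.isOpen_setOfPred_mapsTo isCompact_univ isOpen_Iio
  have hconv : Convex ℝ s := by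
    intro a ha b hb u v hu hv huv x hx
    exact convex_Iio (𝕜 := ℝ) (0 : ℝ) (ha hx) (hb hx) hu hv huv
  have hdisj : Disjoint s (LinearMap.range A : Set C(X, ℝ)) := by
    rw [Set.disjoint_left]
    rintro _ ha ⟨φ, rfl⟩
    refine hφ φ fun x => ?_
    have := ha (Set.mem_univ x)
    simp [A] at this
    linarith
  obtain ⟨l, u, hl, hu⟩ := geometric_hahn_banach_open hconv hs (LinearMap.range A).convex hdisj
  have hu0 : u ≤ 0 := by simpa using hu 0 (Submodule.zero_mem _)
  have hneg : ∀ φ : C(X, ℝ), (∀ x, 0 < φ x) → 0 < l φ := by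
    intro φ h
    have := hl (-φ) (fun x _ => by simpa using h x)
    rw [map_neg] at this
    linarith
  have hzero : ∀ φ, l (A φ) = 0 := by
    intro φ
    by_contra hne
    have := hu (A (((u - 1) / l (A φ)) • φ)) ⟨_, rfl⟩
    rw [map_smul, map_smul, smul_eq_mul, div_mul_cancel₀ _ hne] at this
    linarith
  have hl1 : 0 < l 1 := hneg 1 (fun x => by simp)
  have hnn : ∀ φ : C(X, ℝ), (∀ x, 0 ≤ φ x) → 0 ≤ l φ := by
    intro φ h
    refine le_of_forall_pos_lt_add fun ε hε => ?_
    have := hneg (φ + (ε / l 1) • (1 : C(X, ℝ))) (fun x => by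
      have := h x
      have : 0 < ε / l 1 := by positivity
      simp
      linarith)
    rwa [map_add, map_smul, smul_eq_mul, div_mul_cancel₀ _ hl1.ne'] at this
  obtain ⟨ν, hν, hint⟩ := riesz_aux ((l 1)⁻¹ • l)
    (fun φ h => mul_nonneg (inv_nonneg.2 hl1.le) (hnn φ h)) (by
      simp [hl1.ne'])
  refine ⟨ν, c, hν, hc, fun φ => ?_⟩
  rw [hint, hint]
  have := hzero φ
  simp [A] at this
  simp
  rw [sub_eq_zero.1 this]
  ring

theorem continuous_cons_aux {E : Type*} [TopologicalSpace E] (x : ℕ → E) :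
    Continuous fun a : E => cons a x := by
  refine continuous_pi fun n => ?_
  cases n with
  | zero => exact continuous_id
  | succ n => exact continuous_const

/-- The transpose of the Ruelle operator has an eigenmeasure: there exist a
Borel probability measure `ν` on `Ω` and `c > 0` with `∫ L_f φ dν = c ∫ φ dν` for all
`φ ∈ C(Ω)`. -/
theorem exists_eigenmeasure
    {E : Type*} [MetricSpace E] [CompactSpace E] [MeasurableSpace E] [BorelSpace E]
    (p : Measure E) [IsProbabilityMeasure p]
    (hp : ∀ U : Set E, IsOpen U → U.Nonempty → 0 < p U)
    (f : C(ℕ → E, ℝ))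
    (T : C(ℕ → E, ℝ) →L[ℝ] C(ℕ → E, ℝ))
    (hT : ∀ (φ : C(ℕ → E, ℝ)) (x : ℕ → E),
      T φ x = ∫ a, Real.exp (f (cons a x)) * φ (cons a x) ∂p) :
    ∃ (ν : Measure (ℕ → E)) (c : ℝ), IsProbabilityMeasure ν ∧ 0 < c ∧
      ∀ φ : C(ℕ → E, ℝ), ∫ x, T φ x ∂ν = c * ∫ x, φ x ∂ν := by
  have : Nonempty E := nonempty_of_isProbabilityMeasure p
  refine eigen_aux T (fun φ h x => ?_) (Real.exp (-‖f‖)) (Real.exp_pos _) (fun x => ?_)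
  · rw [hT]
    exact integral_nonneg fun a => mul_nonneg (Real.exp_pos _).le (h _)
  · rw [hT]
    have hcont : Continuous fun a : E => Real.exp (f (cons a x)) :=
      Real.continuous_exp.comp (f.continuous.comp (continuous_cons_aux x))
    have hi : Integrable (fun a : E => Real.exp (f (cons a x))) p :=
      hcont.integrable_of_hasCompactSupport (HasCompactSupport.of_compactSpace _)
    have := integral_mono (μ := p) (integrable_const (Real.exp (-‖f‖))) hi (fun a =>
      Real.exp_le_exp.2 (neg_le_of_abs_le (f.norm_coe_le_norm (cons a x))))
    simpa using this
end
end

section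
/- (Existence of eigenmeasures, Proposition 2.3) Let E be a compact metric space, Ω = E^ℕ, p a fully supported Borel probability measure on E, f ∈ C(Ω), L_f the Ruelle operator, P(f) the pressure of f, and λ_f = exp(P(f)). Then the set G*(f) = { ν Borel probability on Ω : ∫_Ω L_f φ dν = λ_f ∫_Ω φ dν for all φ ∈ C(Ω) } is non-empty. -/
open MeasureTheory Filter Topology

noncomputable section

section EigenHelpers

variable {X : Type*} [TopologicalSpace X] [CompactSpace X]

lemma helper_pow_mono (T : C(X, ℝ) →L[ℝ] C(X, ℝ)) (hm : ∀ φ ψ : C(X, ℝ), φ ≤ ψ → T φ ≤ T ψ)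
    (n : ℕ) : ∀ φ ψ : C(X, ℝ), φ ≤ ψ → (T ^ n) φ ≤ (T ^ n) ψ := by
  induction n with
  | zero => intro φ ψ h; simpa using h
  | succ n ih =>
    intro φ ψ h
    rw [pow_succ]
    exact ih _ _ (hm _ _ h)

lemma helper_pow_ge (T : C(X, ℝ) →L[ℝ] C(X, ℝ)) (hm : ∀ φ ψ : C(X, ℝ), φ ≤ ψ → T φ ≤ T ψ)
    (φ : C(X, ℝ)) (r : ℝ) (hr : 0 ≤ r) (h : r • φ ≤ T φ) (n : ℕ) : r ^ n • φ ≤ (T ^ n) φ := by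
  induction n with
  | zero => simp
  | succ n ih =>
    have h1 : (T ^ n) (r • φ) ≤ (T ^ (n + 1)) φ := by
      rw [pow_succ]
      exact helper_pow_mono T hm n _ _ h
    rw [map_smul] at h1
    refine le_trans ?_ h1
    intro x
    have := ih x
    change r ^ n * φ x ≤ (T ^ n) φ x at this
    change r ^ (n + 1) * φ x ≤ r * (T ^ n) φ x
    calc r ^ (n + 1) * φ x = r * (r ^ n * φ x) := by ring
      _ ≤ _ := mul_le_mul_of_nonneg_left this hr

lemma helper_lim (C r : ℝ) (hC : 0 < C) (hr : 0 < r) :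
    Tendsto (fun n : ℕ => Real.log (C * r ^ n) / n) atTop (𝓝 (Real.log r)) := by
  have h1 : Tendsto (fun n : ℕ => Real.log C / n + Real.log r) atTop (𝓝 (0 + Real.log r)) :=
    (tendsto_const_div_atTop_nhds_zero_nat _).add tendsto_const_nhds
  rw [zero_add] at h1
  refine h1.congr' ?_
  filter_upwards [eventually_gt_atTop 0] with n hn
  have hn' : (n : ℝ) ≠ 0 := by positivity
  rw [Real.log_mul hC.ne' (by positivity), Real.log_pow]
  field_simp

lemma helper_disjoint [Nonempty X] (T : C(X, ℝ) →L[ℝ] C(X, ℝ))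
    (hm : ∀ φ ψ : C(X, ℝ), φ ≤ ψ → T φ ≤ T ψ)
    (hpos : ∀ (n : ℕ) (x : X), 0 < (T ^ n) 1 x) (P : ℝ)
    (hP : ∀ x : X, Tendsto (fun n : ℕ => Real.log ((T ^ n) 1 x) / n) atTop (𝓝 P))
    (φ : C(X, ℝ)) (hφ : ∀ x, 0 < T φ x - Real.exp P * φ x) : False := by
  obtain ⟨x₀, -, hx₀⟩ := isCompact_univ.exists_isMinOn (Set.univ_nonempty (α := X))
    (f := fun x => T φ x - Real.exp P * φ x) (by fun_prop)
  have hmin : ∀ x, T φ x₀ - Real.exp P * φ x₀ ≤ T φ x - Real.exp P * φ x :=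
    fun x => hx₀ (Set.mem_univ x)
  set ε := T φ x₀ - Real.exp P * φ x₀ with hε
  have hε0 : 0 < ε := hφ x₀
  set l := Real.exp P with hl
  have hl0 : 0 < l := Real.exp_pos P
  set K := ‖φ‖ + 1 with hK
  have hK0 : 0 < K := by positivity
  have hφK : ∀ x, |φ x| ≤ K := fun x => by
    have := φ.norm_coe_le_norm x
    rw [Real.norm_eq_abs] at this
    linarith
  set d := min (ε / K) (l / 2) with hd
  have hd0 : 0 < d := by positivity
  have hdK : d * K ≤ ε := by
    have : d ≤ ε / K := min_le_left _ _
    rwa [le_div_iff₀ hK0] at this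
  have hdl : d ≤ l / 2 := min_le_right _ _
  by_cases hc : ∃ x, 0 < φ x
  · obtain ⟨x, hx⟩ := hc
    have h1 : (l + d) • φ ≤ T φ := by
      intro y
      have h2 := hmin y
      have h3 := (abs_le.1 (hφK y)).2
      change (l + d) * φ y ≤ T φ y
      nlinarith
    have h2 : ∀ n, φ x / K * (l + d) ^ n ≤ (T ^ n) 1 x := by
      intro n
      have h3 := helper_pow_ge T hm φ _ (by positivity) h1 n x
      have h4 := helper_pow_mono T hm n φ (K • (1 : C(X, ℝ))) (fun y => by
        simpa using (abs_le.1 (hφK y)).2) x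
      rw [map_smul] at h4
      change (l + d) ^ n * φ x ≤ (T ^ n) φ x at h3
      change (T ^ n) φ x ≤ K * (T ^ n) 1 x at h4
      rw [div_mul_eq_mul_div, div_le_iff₀ hK0]
      linarith
    have h5 : Real.log (l + d) ≤ P := by
      refine le_of_tendsto_of_tendsto' (helper_lim (φ x / K) (l + d) (by positivity)
        (by positivity)) (hP x) fun n => ?_
      gcongr
      exact h2 n
    rw [Real.log_le_iff_le_exp (by positivity)] at h5
    linarith
  · push Not at hc
    have hr : 0 < l - d := by linarith
    have h1 : (l - d) • φ ≤ T φ := by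
      intro y
      have h2 := hmin y
      have h3 := (abs_le.1 (hφK y)).1
      change (l - d) * φ y ≤ T φ y
      nlinarith
    have hlow : ∀ y, φ y ≤ - (ε / l) := by
      intro y
      have h2 := hmin y
      have h3 : T φ y ≤ 0 := by
        have := hm φ 0 (fun z => hc z) y
        simpa using this
      rw [← neg_div, le_div_iff₀ hl0]
      linarith
    obtain ⟨x⟩ := ‹Nonempty X›
    have h2 : ∀ n, (T ^ n) 1 x ≤ K / (ε / l) * (l - d) ^ n := by
      intro n
      have h3 := helper_pow_ge T hm φ _ hr.le h1 n x
      have h4 := helper_pow_mono T hm n φ ((-(ε / l)) • (1 : C(X, ℝ))) (fun y => by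
        simpa using hlow y) x
      rw [map_smul] at h4
      change (l - d) ^ n * φ x ≤ (T ^ n) φ x at h3
      change (T ^ n) φ x ≤ -(ε / l) * (T ^ n) 1 x at h4
      have h6 := (abs_le.1 (hφK x)).1
      have h7 : 0 < (l - d) ^ n := by positivity
      rw [div_mul_eq_mul_div, le_div_iff₀ (by positivity)]
      nlinarith
    have h5 : P ≤ Real.log (l - d) := by
      refine le_of_tendsto_of_tendsto' (hP x) (helper_lim (K / (ε / l)) (l - d) (by positivity)
        hr) fun n => ?_
      gcongr
      · exact hpos n x
      · exact h2 n
    rw [Real.le_log_iff_exp_le hr] at h5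
    linarith

lemma helper_functional [Nonempty X] (T : C(X, ℝ) →L[ℝ] C(X, ℝ)) (l : ℝ)
    (h : ∀ φ : C(X, ℝ), (∀ x, 0 < T φ x - l * φ x) → False) :
    ∃ g : C(X, ℝ) →ₗ[ℝ] ℝ, (∀ φ, 0 ≤ φ → 0 ≤ g φ) ∧ g 1 = 1 ∧ ∀ φ, g (T φ) = l * g φ := by
  let s : Set C(X, ℝ) := {φ | ∀ x, 0 < φ x}
  let S : C(X, ℝ) →ₗ[ℝ] C(X, ℝ) := (T : C(X, ℝ) →ₗ[ℝ] C(X, ℝ)) - l • LinearMap.id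
  have hs1 : Convex ℝ s := by
    intro a ha b hb t u ht hu htu x
    have h1 := ha x
    have h2 := hb x
    simp only [ContinuousMap.add_apply, ContinuousMap.smul_apply, smul_eq_mul]
    rcases ht.eq_or_lt with h0 | h0
    · subst h0
      have : u = 1 := by linarith
      subst this
      simpa using h2
    · have := mul_pos h0 h1
      have := mul_nonneg hu h2.le
      linarith
  have hs2 : IsOpen s := by
    have := ContinuousMap.isOpen_setOfPred_mapsTo (X := X) (Y := ℝ) isCompact_univ
      (isOpen_Ioi (a := (0 : ℝ)))
    convert this using 1
    ext φ
    simp [s, Set.MapsTo]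
  have ht : Convex ℝ (LinearMap.range S : Set C(X, ℝ)) := (LinearMap.range S).convex
  have hdis : Disjoint s (LinearMap.range S : Set C(X, ℝ)) := by
    rw [Set.disjoint_left]
    rintro ψ hψ ⟨φ, rfl⟩
    exact h φ fun x => by simpa [S] using hψ x
  obtain ⟨g, u, hg1, hg2⟩ := geometric_hahn_banach_open hs1 hs2 ht hdis
  have hu : u ≤ 0 := by simpa using hg2 0 (Submodule.zero_mem _)
  have hneg : ∀ φ ∈ s, g φ < 0 := fun φ hφ => (hg1 φ hφ).trans_le hu
  have hzero : ∀ φ, g (S φ) = 0 := by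
    intro φ
    by_contra hne
    have := hg2 (S (((u - 1) / g (S φ)) • φ)) ⟨_, rfl⟩
    rw [map_smul, map_smul, smul_eq_mul, div_mul_cancel₀ _ hne] at this
    linarith
  have h1 : g 1 < 0 := hneg 1 fun x => by simp
  refine ⟨(g 1)⁻¹ • (g : C(X, ℝ) →ₗ[ℝ] ℝ), ?_, ?_, ?_⟩
  · intro φ hφ
    have hle : g φ ≤ 0 := by
      refine le_of_forall_pos_lt_add fun e he => ?_
      have h2 := hneg (φ + (e / (- g 1)) • 1) fun x => by
        have h3 : 0 ≤ φ x := hφ x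
        have : 0 < e / (- g 1) := div_pos he (by linarith)
        simp only [ContinuousMap.add_apply, ContinuousMap.smul_apply, smul_eq_mul,
          ContinuousMap.one_apply, mul_one]
        linarith
      rw [map_add, map_smul, smul_eq_mul] at h2
      have h4 : e / (- g 1) * g 1 = - e := by
        have := h1.ne
        field_simp
      linarith
    simpa using mul_nonneg_of_nonpos_of_nonpos (inv_nonpos.2 h1.le) hle
  · simp [h1.ne]
  · intro φ
    have h2 := hzero φ
    simp only [S, LinearMap.sub_apply, LinearMap.smul_apply, LinearMap.id_apply,
      ContinuousLinearMap.coe_coe, map_sub, map_smul, smul_eq_mul] at h2 ⊢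
    have : g (T φ) = l * g φ := by linarith
    rw [this]; ring

lemma helper_riesz [T2Space X] [MeasurableSpace X] [BorelSpace X]
    (g : C(X, ℝ) →ₗ[ℝ] ℝ) (hg : ∀ φ, 0 ≤ φ → 0 ≤ g φ) (h1 : g 1 = 1) :
    ∃ ν : Measure X, IsProbabilityMeasure ν ∧ ∀ φ : C(X, ℝ), ∫ x, φ x ∂ν = g φ := by
  let L : CompactlySupportedContinuousMap X ℝ →ₗ[ℝ] ℝ :=
    { toFun := fun φ => g φ.toContinuousMap
      map_add' := fun a b => g.map_add a.toContinuousMap b.toContinuousMap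
      map_smul' := fun c a => g.map_smul c a.toContinuousMap }
  let Λ := PositiveLinearMap.mk₀ L (fun φ hφ => hg φ.toContinuousMap hφ)
  have key : ∀ φ : C(X, ℝ), ∫ x, φ x ∂(RealRMK.rieszMeasure Λ) = g φ := fun φ =>
    RealRMK.integral_rieszMeasure Λ (CompactlySupportedContinuousMap.continuousMapEquiv φ)
  refine ⟨RealRMK.rieszMeasure Λ, ⟨?_⟩, key⟩
  have h2 := key 1
  rw [h1] at h2
  simp only [ContinuousMap.one_apply, integral_const, smul_eq_mul, mul_one, Measure.real] at h2
  rw [← ENNReal.toReal_eq_one_iff]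
  exact h2

end EigenHelpers

lemma helper_cons_continuous {E : Type*} [TopologicalSpace E] (x : ℕ → E) :
    Continuous (fun a : E => cons a x) := by
  refine continuous_pi fun n => ?_
  cases n with
  | zero => exact continuous_id
  | succ n => exact continuous_const

/-- **Existence of eigenmeasures.** The set
`G*(f) = { ν : L_f* ν = λ_f ν }` of probability eigenmeasures associated to
`λ_f = exp(P(f))` is non-empty. -/
theorem eigenmeasure_for_spectral_radius_exists
    {E : Type*} [MetricSpace E] [CompactSpace E] [MeasurableSpace E] [BorelSpace E]
    (p : Measure E) [IsProbabilityMeasure p]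
    (hp : ∀ U : Set E, IsOpen U → U.Nonempty → 0 < p U)
    (f : C(ℕ → E, ℝ))
    (T : C(ℕ → E, ℝ) →L[ℝ] C(ℕ → E, ℝ))
    (hT : ∀ (φ : C(ℕ → E, ℝ)) (x : ℕ → E),
      T φ x = ∫ a, Real.exp (f (cons a x)) * φ (cons a x) ∂p)
    (P : ℝ)
    (hP : TendstoUniformly (fun (n : ℕ) (x : ℕ → E) => Real.log ((T ^ n) 1 x) / n)
      (fun _ => P) atTop) :
    ∃ ν : Measure (ℕ → E), IsProbabilityMeasure ν ∧
      ∀ φ : C(ℕ → E, ℝ), ∫ x, T φ x ∂ν = Real.exp P * ∫ x, φ x ∂ν := by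
  have hne : Nonempty E := p.nonempty_of_neZero
  have hInteg : ∀ (φ : C(ℕ → E, ℝ)) (x : ℕ → E),
      Integrable (fun a => Real.exp (f (cons a x)) * φ (cons a x)) p := by
    intro φ x
    have hcont : Continuous (fun a => Real.exp (f (cons a x)) * φ (cons a x)) := by
      have := helper_cons_continuous x
      fun_prop
    exact hcont.integrable_of_hasCompactSupport (HasCompactSupport.of_compactSpace _)
  have hm : ∀ φ ψ : C(ℕ → E, ℝ), φ ≤ ψ → T φ ≤ T ψ := by
    intro φ ψ h x
    change T φ x ≤ T ψ x
    rw [hT, hT]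
    refine integral_mono (hInteg φ x) (hInteg ψ x) fun a => ?_
    exact mul_le_mul_of_nonneg_left (h _) (Real.exp_pos _).le
  have hstrict : ∀ φ : C(ℕ → E, ℝ), (∀ x, 0 < φ x) → ∀ x, 0 < T φ x := by
    intro φ h x
    have hp' : ∀ a, 0 < Real.exp (f (cons a x)) * φ (cons a x) :=
      fun a => mul_pos (Real.exp_pos _) (h _)
    rw [hT, integral_pos_iff_support_of_nonneg (fun a => (hp' a).le) (hInteg φ x)]
    have : Function.support (fun a => Real.exp (f (cons a x)) * φ (cons a x)) = Set.univ :=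
      Set.eq_univ_of_forall fun a => (hp' a).ne'
    rw [this]
    simp
  have hpos : ∀ (n : ℕ) (x : ℕ → E), 0 < (T ^ n) 1 x := by
    intro n
    induction n with
    | zero => intro x; simp
    | succ n ih =>
      rw [pow_succ']
      exact hstrict _ ih
  obtain ⟨g, hg, hg1, hgT⟩ := helper_functional T (Real.exp P)
    (helper_disjoint T hm hpos P fun x => hP.tendsto_at x)
  obtain ⟨ν, hν, hν'⟩ := helper_riesz g hg hg1
  exact ⟨ν, hν, fun φ => by rw [hν', hν', hgT]⟩
end
end
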